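/- Let k, N be natural numbers. Let x_1, …, x_k be nonzero, pairwise distinct complex numbers with x_i x_j ≠ 1 for all 1 ≤ i ≤ j ≤ k, and let t_1, …, t_N be nonzero, pairwise distinct complex numbers with t_i t_j ≠ 1 for all 1 ≤ i ≤ j ≤ N. Then ∏_{i=1}^{k} ∏_{n=1}^{N} (x_i + x_i^{-1} − t_n − t_n^{-1}) = ∑_{λ ⊆ ⟨N^k⟩} (−1)^{Nk − |λ|} · χ_λ^{Sp(2k)}(x_1^{±1}, …, x_k^{±1}) · χ_{λ̃}^{Sp(2N)}(t_1^{±1}, …, t_N^{±1}), where the sum is over all partitions λ with at most k parts, each part at most N, and λ̃ = (k − λ'_N, …, k − λ'_1) with λ'_j = #{i : λ_i ≥ j} the conjugate partition of λ. -/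

import Mathlib

open MeasureTheory Matrix Finset

noncomputable section

instance matrixMeasurableSpace {m n R : Type*} [MeasurableSpace R] :
    MeasurableSpace (Matrix m n R) :=
  MeasurableSpace.pi

/-- `conjP lam j = #{i : lam i ≥ j}`, the `j`-th part of the conjugate partition `λ'`. -/
def conjP {k : ℕ} (lam : Fin k → ℕ) (j : ℕ) : ℕ :=
  (Finset.univ.filter fun i : Fin k => j ≤ lam i).card

/-- The irreducible character `χ_λ^{Sp(2n)}` of the symplectic group attached to a
partition `λ` with at most `n` parts, evaluated at eigenvalues `z_1^{±1}, …, z_n^{±1}`: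
the Weyl character formula ratio
`det(z_j^{λ_i+n−i+1} − z_j^{−(λ_i+n−i+1)}) / det(z_j^{n−i+1} − z_j^{−(n−i+1)})`
(with `1 ≤ i ≤ n`; here rows are `0`-indexed, so the exponents read `λ_i + (n − i)`
and `n − i`). -/
def spChar {n : ℕ} (lam : Fin n → ℕ) (z : Fin n → ℂ) : ℂ :=
  Matrix.det (Matrix.of fun i j : Fin n =>
      z j ^ (lam i + (n - (i : ℕ))) - (z j)⁻¹ ^ (lam i + (n - (i : ℕ)))) /
    Matrix.det (Matrix.of fun i j : Fin n =>
      z j ^ (n - (i : ℕ)) - (z j)⁻¹ ^ (n - (i : ℕ)))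


open Polynomial in
theorem Polynomial.Chebyshev.monic_S_and_natDegree_S {R : Type*} [CommRing R] [Nontrivial R]
    (n : ℕ) : (Chebyshev.S R n).Monic ∧ (Chebyshev.S R n).natDegree = n := by
  induction n using Nat.strong_induction_on with
  | _ n ih =>
    match n with
    | 0 => simp
    | 1 => simp [monic_X]
    | n + 2 =>
      obtain ⟨hm, hd⟩ := ih (n + 1) (by omega)
      obtain ⟨hm', hd'⟩ := ih n (by omega)
      have hXm : (X * Chebyshev.S R ((n + 1 : ℕ) : ℤ)).Monic := monic_X.mul hm
      have hXd : (X * Chebyshev.S R ((n + 1 : ℕ) : ℤ)).natDegree = n + 2 := by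
        rw [monic_X.natDegree_mul hm, hd, natDegree_X]; omega
      have hlt : (Chebyshev.S R (n : ℤ)).degree
          < (X * Chebyshev.S R ((n + 1 : ℕ) : ℤ)).degree := by
        rw [degree_eq_natDegree hm'.ne_zero, degree_eq_natDegree hXm.ne_zero, hd', hXd]
        exact_mod_cast (by omega : n < n + 2)
      have hrec : Chebyshev.S R ((n + 2 : ℕ) : ℤ)
          = X * Chebyshev.S R ((n + 1 : ℕ) : ℤ) - Chebyshev.S R (n : ℤ) := by
        push_cast
        exact Chebyshev.S_add_two R n
      rw [hrec]
      refine ⟨hXm.sub_of_left hlt, ?_⟩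
      rw [natDegree_eq_of_degree_eq (degree_sub_eq_left_of_degree_lt hlt), hXd]

open Polynomial in
theorem Polynomial.Chebyshev.sub_inv_mul_eval_S {K : Type*} [Field K] {z : K} (hz : z ≠ 0)
    (n : ℕ) :
    (z - z⁻¹) * (Chebyshev.S K n).eval (z + z⁻¹) = z ^ (n + 1) - z⁻¹ ^ (n + 1) := by
  induction n using Nat.strong_induction_on with
  | _ n ih =>
    match n with
    | 0 => simp
    | 1 => simp; ring
    | n + 2 =>
      have h1 := ih (n + 1) (by omega)
      have h0 := ih n (by omega)
      have hrec : Chebyshev.S K ((n + 2 : ℕ) : ℤ)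
          = X * Chebyshev.S K ((n + 1 : ℕ) : ℤ) - Chebyshev.S K (n : ℤ) := by
        push_cast
        exact Chebyshev.S_add_two K n
      have hzz : z * z⁻¹ = 1 := mul_inv_cancel₀ hz
      rw [hrec, eval_sub, eval_mul, eval_X]
      linear_combination (z + z⁻¹) * h1 - h0 + (z ^ (n + 1) - z⁻¹ ^ (n + 1)) * hzz

/-- The ratio of determinants defining `spChar`, written in the variables `z + z⁻¹`. -/
theorem spChar_eq_div_vandermonde {n : ℕ} (lam : Fin n → ℕ) {z : Fin n → ℂ}
    (hz0 : ∀ i, z i ≠ 0) (hz1 : ∀ i, z i * z i ≠ 1) :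
    spChar lam z =
      (of fun i j : Fin n => (Polynomial.Chebyshev.S ℂ ((lam i.rev + i : ℕ) : ℤ)).eval
          (z j + (z j)⁻¹)).det /
        (vandermonde fun j => z j + (z j)⁻¹).det := by
  have key (mu : Fin n → ℕ) :
      (of fun i j : Fin n => z j ^ (mu i + (n - (i : ℕ))) - (z j)⁻¹ ^ (mu i + (n - (i : ℕ)))).det
        = (∏ j, (z j - (z j)⁻¹)) * (((Equiv.Perm.sign (Fin.revPerm (n := n)) : ℤ) : ℂ) *
          (of fun i j : Fin n => (Polynomial.Chebyshev.S ℂ ((mu i.rev + i : ℕ) : ℤ)).eval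
            (z j + (z j)⁻¹)).det) := by
    rw [← det_permute, ← det_mul_row]
    congr 1
    ext i j
    have hi := i.isLt
    simp only [of_apply, submatrix_apply, id, Fin.revPerm_apply, Fin.rev_rev, Fin.val_rev]
    rw [Polynomial.Chebyshev.sub_inv_mul_eval_S (hz0 j)]
    congr 2 <;> omega
  have hprod : (∏ j, (z j - (z j)⁻¹)) ≠ 0 := by
    refine Finset.prod_ne_zero_iff.2 fun j _ h => hz1 j ?_
    nth_rw 2 [sub_eq_zero.1 h]
    exact mul_inv_cancel₀ (hz0 j)
  have hsign : ((Equiv.Perm.sign (Fin.revPerm (n := n)) : ℤ) : ℂ) ≠ 0 := by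
    exact_mod_cast (Equiv.Perm.sign (Fin.revPerm (n := n))).ne_zero
  have hden := key fun _ => 0
  simp only [zero_add] at hden
  unfold spChar
  rw [key, hden, mul_div_mul_left _ _ hprod, mul_div_mul_left _ _ hsign,
    det_eval_matrixOfPolynomials_eq_det_vandermonde _
      (fun i : Fin n => Polynomial.Chebyshev.S ℂ ((i : ℕ) : ℤ))
      (fun i => (Polynomial.Chebyshev.monic_S_and_natDegree_S _).2)
      (fun i => (Polynomial.Chebyshev.monic_S_and_natDegree_S _).1),
    ← det_transpose (of fun i j : Fin n =>
      (Polynomial.Chebyshev.S ℂ ((j : ℕ) : ℤ)).eval (z i + (z i)⁻¹))]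
  rfl

theorem conjP_le {k : ℕ} (lam : Fin k → ℕ) (j : ℕ) : conjP lam j ≤ k :=
  (card_filter_le _ _).trans (by simp)

theorem conjP_antitone {k : ℕ} (lam : Fin k → ℕ) : Antitone (conjP lam) := fun _ _ h =>
  card_le_card fun _ hi => by
    simp only [mem_filter, mem_univ, true_and] at hi ⊢
    exact h.trans hi

theorem lt_conjP_iff {k : ℕ} {lam : Fin k → ℕ} (h : Antitone lam) (i : Fin k) (j : ℕ) :
    (i : ℕ) < conjP lam j ↔ j ≤ lam i := by
  constructor
  · intro hi
    by_contra hj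
    have hsub : (univ.filter fun a : Fin k => j ≤ lam a) ⊆ Iio i := fun a ha => by
      simp only [mem_filter, mem_univ, true_and, mem_Iio] at ha ⊢
      by_contra hai
      exact hj (ha.trans (h (not_lt.1 hai)))
    have := card_le_card hsub
    rw [Fin.card_Iio] at this
    exact absurd hi (not_lt.2 this)
  · intro hj
    have hsub : Iic i ⊆ univ.filter fun a : Fin k => j ≤ lam a := fun a ha => by
      simp only [mem_filter, mem_univ, true_and, mem_Iic] at ha ⊢
      exact hj.trans (h ha)
    have := card_le_card hsub
    rw [Fin.card_Iic] at this
    exact this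

section Shuffle

variable {k N : ℕ}

/-- The rows attached to the parts of a partition `lam` in a `k × N` box, in increasing order. -/
def partRow (lam : Fin k → Fin (N + 1)) (i : Fin k) : Fin (k + N) :=
  ⟨lam i.rev + i, by omega⟩

/-- The rows attached to the parts of the complementary conjugate partition, in increasing
order. -/
def conjRow (lam : Fin k → Fin (N + 1)) (m : Fin N) : Fin (k + N) :=
  ⟨k - conjP (fun i => (lam i : ℕ)) (m + 1) + m, by omega⟩

theorem partRow_strictMono {lam : Fin k → Fin (N + 1)} (h : Antitone lam) :
    StrictMono (partRow lam) := fun i j hij => by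
  have : lam i.rev ≤ lam j.rev := h (Fin.rev_le_rev.2 hij.le)
  have h1 : (lam i.rev : ℕ) ≤ lam j.rev := this
  have h2 : (i : ℕ) < j := hij
  show (lam i.rev : ℕ) + i < lam j.rev + j
  omega

theorem conjRow_strictMono (lam : Fin k → Fin (N + 1)) : StrictMono (conjRow lam) :=
  fun i j hij => by
  have h2 : (i : ℕ) < j := hij
  have h1 := conjP_antitone (fun i => (lam i : ℕ)) (show (i : ℕ) + 1 ≤ j + 1 by omega)
  show k - conjP (fun i => (lam i : ℕ)) (i + 1) + (i : ℕ)
    < k - conjP (fun i => (lam i : ℕ)) (j + 1) + (j : ℕ)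
  omega

theorem partRow_lt_conjRow {lam : Fin k → Fin (N + 1)} (h : Antitone lam) {i : Fin k} {m : Fin N}
    (hm : (lam i.rev : ℕ) ≤ m) : partRow lam i < conjRow lam m := by
  have hlt := lt_conjP_iff (lam := fun i => (lam i : ℕ)) (fun _ _ hab => h hab) i.rev (m + 1)
  have hi := i.isLt
  rw [Fin.val_rev] at hlt
  show (lam i.rev : ℕ) + i < k - conjP (fun i => (lam i : ℕ)) (m + 1) + (m : ℕ)
  omega

theorem conjRow_lt_partRow {lam : Fin k → Fin (N + 1)} (h : Antitone lam) {i : Fin k} {m : Fin N}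
    (hm : (m : ℕ) < lam i.rev) : conjRow lam m < partRow lam i := by
  have hlt := lt_conjP_iff (lam := fun i => (lam i : ℕ)) (fun _ _ hab => h hab) i.rev (m + 1)
  have hle := conjP_le (fun i => (lam i : ℕ)) (m + 1)
  have hi := i.isLt
  rw [Fin.val_rev] at hlt
  show k - conjP (fun i => (lam i : ℕ)) (m + 1) + (m : ℕ) < (lam i.rev : ℕ) + i
  omega

theorem partRow_ne_conjRow {lam : Fin k → Fin (N + 1)} (h : Antitone lam) (i : Fin k)
    (m : Fin N) : partRow lam i ≠ conjRow lam m := by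
  rcases le_or_gt (lam i.rev : ℕ) m with hm | hm
  · exact (partRow_lt_conjRow h hm).ne
  · exact (conjRow_lt_partRow h hm).ne'

theorem shuffle_injective {lam : Fin k → Fin (N + 1)} (h : Antitone lam) :
    Function.Injective (Sum.elim (partRow lam) (conjRow lam)) :=
  (partRow_strictMono h).injective.sumElim (conjRow_strictMono lam).injective
    (partRow_ne_conjRow h)

/-- The bijection enumerating the rows attached to `lam`, then those attached to its
complementary conjugate. -/
def shuffleEquiv (lam : {lam : Fin k → Fin (N + 1) // Antitone lam}) :
    Fin k ⊕ Fin N ≃ Fin (k + N) :=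
  Equiv.ofBijective _ ((Fintype.bijective_iff_injective_and_card _).2
    ⟨shuffle_injective lam.2, by simp⟩)

/-- `shuffleEquiv` as a permutation of `Fin (k + N)`. -/
def shufflePerm (lam : {lam : Fin k → Fin (N + 1) // Antitone lam}) :
    Equiv.Perm (Fin (k + N)) :=
  finSumFinEquiv.symm.trans (shuffleEquiv lam)

theorem shufflePerm_castAdd (lam : {lam : Fin k → Fin (N + 1) // Antitone lam}) (i : Fin k) :
    shufflePerm lam (Fin.castAdd N i) = partRow lam.1 i := by
  simp [shufflePerm, shuffleEquiv]

theorem shufflePerm_natAdd (lam : {lam : Fin k → Fin (N + 1) // Antitone lam}) (m : Fin N) :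
    shufflePerm lam (Fin.natAdd k m) = conjRow lam.1 m := by
  simp [shufflePerm, shuffleEquiv]

theorem prod_prod_Ioi_univ_add {M : Type*} [CommMonoid M] (f : Fin (k + N) → Fin (k + N) → M) :
    ∏ i, ∏ j ∈ Ioi i, f i j =
      (∏ i : Fin k, ∏ j ∈ Ioi i, f (Fin.castAdd N i) (Fin.castAdd N j)) *
      (∏ i : Fin k, ∏ m : Fin N, f (Fin.castAdd N i) (Fin.natAdd k m)) *
      ∏ m : Fin N, ∏ m' ∈ Ioi m, f (Fin.natAdd k m) (Fin.natAdd k m') := by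
  have hIoi {n : ℕ} (i : Fin n) (g : Fin n → M) :
      ∏ j ∈ Ioi i, g j = ∏ j, if i < j then g j else 1 := by
    rw [← prod_filter]
    congr 1
    ext; simp
  have hlt (i : Fin k) (m : Fin N) : Fin.castAdd N i < Fin.natAdd k m := by
    rw [Fin.lt_def, Fin.val_castAdd, Fin.val_natAdd]; omega
  have hlt' (i j : Fin k) : Fin.castAdd N i < Fin.castAdd N j ↔ i < j := Iff.rfl
  simp only [hIoi, Fin.prod_univ_add, hlt, (hlt _ _).not_gt, if_true, if_false, prod_const_one,
    prod_mul_distrib, Fin.natAdd_lt_natAdd_iff, hlt', mul_one,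
    mul_assoc]

theorem sign_shufflePerm (lam : {lam : Fin k → Fin (N + 1) // Antitone lam}) :
    Equiv.Perm.sign (shufflePerm lam) = (-1) ^ ∑ i, (lam.1 i : ℕ) := by
  rw [Equiv.Perm.sign_eq_prod_prod_Ioi, prod_prod_Ioi_univ_add]
  simp only [shufflePerm_castAdd, shufflePerm_natAdd]
  have h1 : ∏ i : Fin k, ∏ j ∈ Ioi i,
      (if partRow lam.1 i < partRow lam.1 j then (1 : ℤˣ) else -1) = 1 :=
    prod_eq_one fun i _ => prod_eq_one fun j hj =>
      if_pos (partRow_strictMono lam.2 (mem_Ioi.1 hj))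
  have h2 : ∏ i : Fin N, ∏ j ∈ Ioi i,
      (if conjRow lam.1 i < conjRow lam.1 j then (1 : ℤˣ) else -1) = 1 :=
    prod_eq_one fun i _ => prod_eq_one fun j hj =>
      if_pos (conjRow_strictMono lam.1 (mem_Ioi.1 hj))
  have h3 (i : Fin k) : ∏ m : Fin N,
      (if partRow lam.1 i < conjRow lam.1 m then (1 : ℤˣ) else -1)
        = (-1) ^ (lam.1 i.rev : ℕ) := by
    have hiff (m : Fin N) : partRow lam.1 i < conjRow lam.1 m ↔ ¬ (m : ℕ) < lam.1 i.rev := by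
      refine ⟨fun h hm => (conjRow_lt_partRow lam.2 hm).not_gt h,
        fun h => partRow_lt_conjRow lam.2 (not_lt.1 h)⟩
    simp only [hiff, ite_not]
    rw [← prod_filter, prod_const, Fin.card_filter_val_lt, min_eq_right]
    omega
  simp only [h1, h2, h3, one_mul, mul_one]
  rw [prod_pow_eq_pow_sum, ← Equiv.sum_comp Fin.revPerm fun i => (lam.1 i : ℕ)]
  rfl

/-- The permutation of `Fin (k + N)` permuting the two blocks and then applying a shuffle. -/
def blockPerm
    (p : {lam : Fin k → Fin (N + 1) // Antitone lam} × Equiv.Perm (Fin k) × Equiv.Perm (Fin N)) :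
    Equiv.Perm (Fin (k + N)) :=
  shufflePerm p.1 * finSumFinEquiv.permCongr (Equiv.Perm.sumCongr p.2.1 p.2.2)

theorem blockPerm_castAdd
    (p : {lam : Fin k → Fin (N + 1) // Antitone lam} × Equiv.Perm (Fin k) × Equiv.Perm (Fin N))
    (i : Fin k) : blockPerm p (Fin.castAdd N i) = partRow p.1.1 (p.2.1 i) := by
  simp [blockPerm, ← shufflePerm_castAdd]

theorem blockPerm_natAdd
    (p : {lam : Fin k → Fin (N + 1) // Antitone lam} × Equiv.Perm (Fin k) × Equiv.Perm (Fin N))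
    (m : Fin N) : blockPerm p (Fin.natAdd k m) = conjRow p.1.1 (p.2.2 m) := by
  simp [blockPerm, ← shufflePerm_natAdd]

theorem partRow_injective : Function.Injective (partRow : (Fin k → Fin (N + 1)) → _) := by
  intro lam mu h
  ext i
  have := congrArg Fin.val (congrFun h i.rev)
  simpa [partRow] using this

theorem blockPerm_injective : Function.Injective (blockPerm (k := k) (N := N)) := by
  rintro ⟨lam, a, b⟩ ⟨mu, c, d⟩ h
  have hl (i : Fin k) : partRow lam.1 (a i) = partRow mu.1 (c i) := by
    simpa only [blockPerm_castAdd] using congrArg (· (Fin.castAdd N i)) h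
  have hr (m : Fin N) : conjRow lam.1 (b m) = conjRow mu.1 (d m) := by
    simpa only [blockPerm_natAdd] using congrArg (· (Fin.natAdd k m)) h
  have hrange : Set.range (partRow lam.1) = Set.range (partRow mu.1) := by
    rw [← a.surjective.range_comp (partRow lam.1), ← c.surjective.range_comp (partRow mu.1)]
    exact congrArg Set.range (funext hl)
  obtain rfl : lam = mu := Subtype.ext <| partRow_injective <|
    ((partRow_strictMono lam.2).range_inj (partRow_strictMono mu.2)).1 hrange
  obtain rfl : a = c := Equiv.ext fun i => (partRow_strictMono lam.2).injective (hl i)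
  obtain rfl : b = d := Equiv.ext fun m => (conjRow_strictMono lam.1).injective (hr m)
  rfl

theorem exists_partRow_eq {f : Fin k → Fin (k + N)} (hf : StrictMono f) :
    ∃ lam : Fin k → Fin (N + 1), Antitone lam ∧ partRow lam = f := by
  have hstep (d : ℕ) : ∀ i j : Fin k, (j : ℕ) = i + d → (f i : ℕ) + d ≤ f j := by
    induction d with
    | zero =>
      intro i j h
      rw [show i = j from Fin.ext (by omega)]
      simp
    | succ d ih =>
      intro i j h
      have h1 := ih i ⟨i + d, by omega⟩ rfl
      have h2 : f ⟨i + d, by omega⟩ < f j := hf (Fin.lt_def.2 (by simp only; omega))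
      have h3 := Fin.lt_def.1 h2
      omega
  have hle (i j : Fin k) (hij : i ≤ j) : (f i : ℕ) + j ≤ f j + i := by
    have h1 : (i : ℕ) ≤ j := hij
    have := hstep (j - i) i j (by omega)
    omega
  have hlow (i : Fin k) : (i : ℕ) ≤ f i := by
    have := hle ⟨0, i.pos⟩ i (Fin.le_def.2 (Nat.zero_le _))
    simp only at this
    omega
  have hup (i : Fin k) : (f i : ℕ) ≤ N + i := by
    have h1 := hle i ⟨k - 1, Nat.sub_lt i.pos one_pos⟩ (Fin.le_def.2 (by simp only; omega))
    have h2 := (f ⟨k - 1, Nat.sub_lt i.pos one_pos⟩).isLt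
    simp only at h1
    omega
  refine ⟨fun i => ⟨f i.rev - i.rev, ?_⟩, fun i j hij => ?_, ?_⟩
  · have := hup i.rev
    omega
  · have h1 := hle j.rev i.rev (Fin.rev_le_rev.2 hij)
    have h2 := hlow j.rev
    have h3 := hlow i.rev
    rw [Fin.le_def]
    simp only
    omega
  · ext i
    have := hlow i
    simp only [partRow, Fin.rev_rev]
    omega

theorem blockPerm_surjective : Function.Surjective (blockPerm (k := k) (N := N)) := by
  intro σ
  have hfi : Function.Injective fun i => σ (Fin.castAdd N i) :=
    σ.injective.comp (Fin.castAdd_injective k N)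
  have hgi : Function.Injective fun m => σ (Fin.natAdd k m) :=
    σ.injective.comp (Fin.natAdd_injective N k)
  set a := Tuple.sort fun i => σ (Fin.castAdd N i)
  set b := Tuple.sort fun m => σ (Fin.natAdd k m)
  have hf : StrictMono ((fun i => σ (Fin.castAdd N i)) ∘ a) :=
    (Tuple.monotone_sort _).strictMono_of_injective (hfi.comp a.injective)
  have hg : StrictMono ((fun m => σ (Fin.natAdd k m)) ∘ b) :=
    (Tuple.monotone_sort _).strictMono_of_injective (hgi.comp b.injective)
  obtain ⟨lam, hlam, hrow⟩ := exists_partRow_eq hf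
  have hcompl (σ' : Equiv.Perm (Fin (k + N))) :
      Set.range (fun m => σ' (Fin.natAdd k m)) = (Set.range fun i => σ' (Fin.castAdd N i))ᶜ := by
    ext r
    obtain ⟨s, rfl⟩ := σ'.surjective r
    induction s using Fin.addCases with
    | left i => simp [Fin.ext_iff]; intro m; omega
    | right m => simp [Fin.ext_iff]; intro i; omega
  have hconj : conjRow lam = (fun m => σ (Fin.natAdd k m)) ∘ b := by
    rw [← (conjRow_strictMono lam).range_inj hg, b.surjective.range_comp, hcompl]
    have h1 := hcompl (shufflePerm ⟨lam, hlam⟩)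
    simp only [shufflePerm_natAdd, shufflePerm_castAdd] at h1
    rw [show Set.range (conjRow lam) = (Set.range (partRow lam))ᶜ from h1, hrow,
      a.surjective.range_comp]
  refine ⟨(⟨lam, hlam⟩, a⁻¹, b⁻¹), ?_⟩
  ext1 r
  induction r using Fin.addCases with
  | left i => simp [blockPerm_castAdd, hrow]
  | right m => simp [blockPerm_natAdd, hconj]

/-- Laplace expansion of a determinant along its first `k` columns, with row sets indexed by
partitions in a `k × N` box. -/
theorem det_eq_sum_partitions {R : Type*} [CommRing R]
    (A : Matrix (Fin (k + N)) (Fin (k + N)) R) :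
    A.det = ∑ lam : {lam : Fin k → Fin (N + 1) // Antitone lam},
      (-1) ^ (∑ i, (lam.1 i : ℕ)) *
        (A.submatrix (partRow lam.1) (Fin.castAdd N)).det *
        (A.submatrix (conjRow lam.1) (Fin.natAdd k)).det := by
  have hbij : Function.Bijective (blockPerm (k := k) (N := N)) :=
    ⟨blockPerm_injective, blockPerm_surjective⟩
  rw [det_apply', ← hbij.sum_comp, Fintype.sum_prod_type]
  refine sum_congr rfl fun lam _ => ?_
  rw [det_apply', det_apply', mul_assoc, sum_mul_sum, mul_sum, Fintype.sum_prod_type]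
  refine sum_congr rfl fun a _ => ?_
  rw [mul_sum]
  refine sum_congr rfl fun b _ => ?_
  rw [Fin.prod_univ_add]
  simp only [blockPerm_castAdd, blockPerm_natAdd, submatrix_apply]
  rw [blockPerm, Equiv.Perm.sign_mul, sign_shufflePerm, Equiv.Perm.sign_permCongr,
    Equiv.Perm.sign_sumCongr]
  push_cast
  ring

end Shuffle

/-- Dual Cauchy identity for determinants in monic polynomials `p n` of degree `n`, before division
by the Vandermonde determinants. -/
theorem prod_mul_det_vandermonde_eq_sum {k N : ℕ} {R : Type*} [CommRing R] [Nontrivial R]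
    (p : ℕ → Polynomial R) (hd : ∀ n, (p n).natDegree = n) (hm : ∀ n, (p n).Monic)
    (u : Fin k → R) (v : Fin N → R) :
    (∏ i, ∏ m, (v m - u i)) * (vandermonde u).det * (vandermonde v).det =
      ∑ lam : {lam : Fin k → Fin (N + 1) // Antitone lam}, (-1) ^ (∑ i, (lam.1 i : ℕ)) *
        (of fun i j => (p (partRow lam.1 i)).eval (u j)).det *
        (of fun i j => (p (conjRow lam.1 i)).eval (v j)).det := by
  have h := det_eval_matrixOfPolynomials_eq_det_vandermonde (Fin.append u v)
    (fun r : Fin (k + N) => p r) (fun r => hd r) (fun r => hm r)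
  rw [det_vandermonde, prod_prod_Ioi_univ_add, ← det_transpose, det_eq_sum_partitions] at h
  simp only [Fin.append_left, Fin.append_right] at h
  rw [det_vandermonde, det_vandermonde, mul_comm (∏ i, ∏ m, (v m - u i)), h]
  refine sum_congr rfl fun lam _ => ?_
  congr 3
  · ext i j
    simp
  · ext i j
    simp

theorem det_vandermonde_add_inv_ne_zero {n : ℕ} {z : Fin n → ℂ} (hz0 : ∀ i, z i ≠ 0)
    (hinj : Function.Injective z) (hz1 : ∀ i j : Fin n, i ≤ j → z i * z j ≠ 1) :
    (vandermonde fun j => z j + (z j)⁻¹).det ≠ 0 := by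
  rw [det_vandermonde_ne_zero_iff]
  intro i j hij
  have hij' : (z i - z j) * (z i * z j - 1) = 0 := by
    have hi := hz0 i
    have hj := hz0 j
    simp only at hij
    field_simp at hij
    linear_combination hij
  rcases mul_eq_zero.1 hij' with h | h
  · exact hinj (sub_eq_zero.1 h)
  · rcases le_total i j with hle | hle
    · exact absurd (sub_eq_zero.1 h) (hz1 i j hle)
    · exact absurd (mul_comm (z i) (z j) ▸ sub_eq_zero.1 h) (hz1 j i hle)

/-- **Symplectic dual-Cauchy decomposition (Jimbo–Miwa / Howe).** For `x_1, …, x_k` and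
`t_1, …, t_N` nonzero, pairwise distinct, with `x_i x_j ≠ 1` (`i ≤ j`) and `t_i t_j ≠ 1`
(`i ≤ j`), `∏_{i,n} (x_i + x_i⁻¹ − t_n − t_n⁻¹)
  = ∑_{λ ⊆ ⟨N^k⟩} (−1)^{Nk−|λ|} χ_λ^{Sp(2k)}(x^{±1}) χ_{λ̃}^{Sp(2N)}(t^{±1})`,
summed over partitions `λ` with at most `k` parts, each at most `N` (encoded as
antitone functions `Fin k → Fin (N+1)`), where `λ̃ = (k − λ'_N, …, k − λ'_1)`. -/
theorem prod_eq_sum_sp_chars (k N : ℕ)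
    (x : Fin k → ℂ) (hx0 : ∀ i, x i ≠ 0) (hxinj : Function.Injective x)
    (hx1 : ∀ i j : Fin k, i ≤ j → x i * x j ≠ 1)
    (t : Fin N → ℂ) (ht0 : ∀ i, t i ≠ 0) (htinj : Function.Injective t)
    (ht1 : ∀ i j : Fin N, i ≤ j → t i * t j ≠ 1) :
    (∏ i : Fin k, ∏ n : Fin N, (x i + (x i)⁻¹ - t n - (t n)⁻¹))
      = ∑ lam ∈ Finset.univ.filter
          (fun lam : Fin k → Fin (N + 1) => ∀ i j : Fin k, i ≤ j → lam j ≤ lam i),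
          (-1 : ℂ) ^ (N * k - ∑ i : Fin k, (lam i : ℕ)) *
            spChar (fun i : Fin k => (lam i : ℕ)) x *
            spChar (fun m : Fin N => k - conjP (fun i : Fin k => (lam i : ℕ)) (N - (m : ℕ))) t := by
  have hV := det_vandermonde_add_inv_ne_zero hx0 hxinj hx1
  have hW := det_vandermonde_add_inv_ne_zero ht0 htinj ht1
  have hmain := prod_mul_det_vandermonde_eq_sum (fun n : ℕ => Polynomial.Chebyshev.S ℂ (n : ℤ))
    (fun n => (Polynomial.Chebyshev.monic_S_and_natDegree_S n).2)
    (fun n => (Polynomial.Chebyshev.monic_S_and_natDegree_S n).1)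
    (fun i => x i + (x i)⁻¹) (fun m => t m + (t m)⁻¹)
  have hneg : ∏ i : Fin k, ∏ n : Fin N, (x i + (x i)⁻¹ - t n - (t n)⁻¹) =
      (-1) ^ (N * k) * ∏ i : Fin k, ∏ n : Fin N, (t n + (t n)⁻¹ - (x i + (x i)⁻¹)) := by
    rw [pow_mul, ← Fin.prod_const k, ← prod_mul_distrib]
    refine prod_congr rfl fun i _ => ?_
    rw [← Fin.prod_const N, ← prod_mul_distrib]
    exact prod_congr rfl fun n _ => by ring
  rw [mul_assoc, ← eq_div_iff (mul_ne_zero hV hW), sum_div] at hmain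
  rw [hneg, hmain, mul_sum, Finset.sum_subtype (p := Antitone) _
    (fun lam => by simp only [mem_filter, mem_univ, true_and]; rfl)]
  refine sum_congr rfl fun lam _ => ?_
  rw [spChar_eq_div_vandermonde _ hx0 fun i => hx1 i i le_rfl,
    spChar_eq_div_vandermonde _ ht0 fun i => ht1 i i le_rfl]
  have hle : ∑ i, (lam.1 i : ℕ) ≤ N * k := by
    calc ∑ i, (lam.1 i : ℕ) ≤ ∑ _i : Fin k, N := sum_le_sum fun i _ => by omega
      _ = N * k := by simp [mul_comm]
  have hsign : (-1 : ℂ) ^ (N * k) * (-1) ^ (∑ i, (lam.1 i : ℕ))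
      = (-1) ^ (N * k - ∑ i, (lam.1 i : ℕ)) := by
    rw [← Nat.sub_add_cancel hle, pow_add, Nat.add_sub_cancel, mul_assoc, ← pow_add,
      (Even.add_self _).neg_one_pow, mul_one]
  have hrow (m : Fin N) : k - conjP (fun i => (lam.1 i : ℕ)) (N - (m.rev : ℕ)) + (m : ℕ)
      = conjRow lam.1 m := by
    have := m.isLt
    rw [Fin.val_rev, show N - (N - ((m : ℕ) + 1)) = m + 1 by omega]
    rfl
  simp only [hrow]
  rw [← hsign]
  simp only [partRow]
  ring
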